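/- For every k ≥ 1, the number of non-tracking binary strings of length k equals the number of multisets d of natural numbers such that there exists a tournament on Fin (k+2) with score multiset d and any two tournaments on Fin (k+2) with score multiset d are isomorphic (i.e., NTr(k) equals the number of unique tournaments on k+2 nodes, counted up to isomorphism via their score vectors). -/

import Mathlib

/-- The four patterns whose presence as a contiguous substring produces a track
under the rule "3 out of 5 with loss 2". -/
def trackPatterns : List (List Bool) :=
  [[true, true, true], [true, false, true, true],
   [true, true, false, true], [true, false, true, false, true]]

/-- A binary string is non-tracking if it contains none of the tracking patterns
as a contiguous (infix) substring. -/
def NonTracking (s : List Bool) : Prop :=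
  ∀ p ∈ trackPatterns, ¬ p <:+: s

/-- `NTr k` is the number of non-tracking binary strings of length `k`. -/
noncomputable def NTr (k : ℕ) : ℕ :=
  Nat.card {s : List Bool // s.length = k ∧ NonTracking s}

/-- A string is initial-loss if each of its first two entries (those that exist) is `0`. -/
def InitialLoss (s : List Bool) : Prop :=
  ∀ (i : ℕ) (h : i < s.length), i < 2 → s[i] = false

/-- The four basic blocks `0`, `001`, `0011`, `00101`. -/
def basicBlocks : List (List Bool) :=
  [[false], [false, false, true], [false, false, true, true],
   [false, false, true, false, true]]

/-- A tournament: an irreflexive relation such that for `i ≠ j` exactly one of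
`r i j`, `r j i` holds. -/
def IsTournament {α : Type*} (r : α → α → Prop) : Prop :=
  (∀ i, ¬ r i i) ∧ ∀ i j : α, i ≠ j → Xor' (r i j) (r j i)

/-- The score of vertex `i`: the number of vertices `j` it beats. -/
noncomputable def score {α : Type*} [Fintype α] (r : α → α → Prop) (i : α) : ℕ :=
  Nat.card {j : α // r i j}

/-- The score multiset of a tournament: the multiset of scores of all vertices. -/
noncomputable def scoreMultiset {α : Type*} [Fintype α] (r : α → α → Prop) : Multiset ℕ :=
  (Finset.univ : Finset α).val.map (score r)

/-- Two tournaments are isomorphic if some bijection of the vertices carries one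
relation to the other. -/
def Isomorphic {α β : Type*} (r : α → α → Prop) (r' : β → β → Prop) : Prop :=
  ∃ e : α ≃ β, ∀ i j : α, r i j ↔ r' (e i) (e j)

/-- The dual tournament: all edges reversed. -/
def dualT {α : Type*} (r : α → α → Prop) : α → α → Prop :=
  fun i j => r j i

/-- The composition `A + B`: within each summand play as before, and every vertex of
the second summand beats every vertex of the first. -/
def compT {α β : Type*} (A : α → α → Prop) (B : β → β → Prop) : α ⊕ β → α ⊕ β → Prop
  | Sum.inl i, Sum.inl j => A i j
  | Sum.inr i, Sum.inr j => B i j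
  | Sum.inr _, Sum.inl _ => True
  | Sum.inl _, Sum.inr _ => False

/-- The sizes of the strong tournaments that are determined by their scores. -/
inductive Block
  | one
  | three
  | four
  | five

namespace Block

/-- The number of vertices of a block. -/
def size : Block → ℕ
  | one => 1
  | three => 3
  | four => 4
  | five => 5

/-- The score multiset of a block. -/
def scores : Block → Multiset ℕ
  | one => {0}
  | three => {1, 1, 1}
  | four => {1, 1, 2, 2}
  | five => {2, 2, 2, 2, 2}

/-- The basic string attached to a block, read from right to left. -/
def code : Block → List Bool
  | one => [false]
  | three => [true, false, false]
  | four => [true, true, false, false]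
  | five => [true, false, true, false, false]

lemma card_scores (b : Block) : Multiset.card b.scores = b.size := by
  cases b <;> rfl

lemma length_code (b : Block) : b.code.length = b.size := by
  cases b <;> rfl

/-- The total number of vertices of a list of blocks. -/
def totalSize : List Block → ℕ
  | [] => 0
  | b :: bs => b.size + totalSize bs

/-- The score multiset of the composition of a list of blocks, weakest block first. -/
def totalScores : List Block → Multiset ℕ
  | [] => 0
  | b :: bs => b.scores + (totalScores bs).map (· + b.size)

/-- The concatenation of the codes of a list of blocks. -/
def totalCode : List Block → List Bool
  | [] => []
  | b :: bs => b.code ++ totalCode bs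

lemma card_totalScores (bs : List Block) :
    Multiset.card (totalScores bs) = totalSize bs := by
  induction bs with
  | nil => rfl
  | cons b bs ih => simp [totalScores, totalSize, card_scores, ih]

lemma length_totalCode (bs : List Block) : (totalCode bs).length = totalSize bs := by
  induction bs with
  | nil => rfl
  | cons b bs ih => simp [totalCode, totalSize, length_code, ih]

lemma totalCode_injective : Function.Injective totalCode := by
  intro bs
  induction bs with
  | nil =>
    intro cs h
    cases cs with
    | nil => rfl
    | cons c cs => cases c <;> simp [totalCode, code] at h
  | cons b bs ih =>
    intro cs h
    cases cs with
    | nil => cases b <;> simp [totalCode, code] at h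
    | cons c cs =>
      cases b <;> cases c <;> simp [totalCode, code] at h <;> rw [ih h]

lemma eq_of_scores_add_eq {b c : Block} {s t : Multiset ℕ}
    (h : b.scores + s.map (· + b.size) = c.scores + t.map (· + c.size)) : b = c := by
  have h0 := congrArg (Multiset.count 0) h
  have h1 := congrArg (Multiset.count 1) h
  have key (n m : ℕ) (hm : n < m) (s : Multiset ℕ) : Multiset.count n (s.map (· + m)) = 0 := by
    rw [Multiset.count_eq_zero, Multiset.mem_map]
    rintro ⟨x, -, hx⟩
    omega
  cases b <;> cases c <;> first
    | rfl
    | (exfalso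
       simp only [Multiset.count_add, scores, size] at h0 h1
       simp at h0 h1)

lemma totalScores_injective : Function.Injective totalScores := by
  intro bs
  induction bs with
  | nil =>
    intro cs h
    cases cs with
    | nil => rfl
    | cons c cs =>
      have := congrArg Multiset.card h
      cases c <;> simp [totalScores, scores] at this
  | cons b bs ih =>
    intro cs h
    cases cs with
    | nil =>
      have := congrArg Multiset.card h
      cases b <;> simp [totalScores, scores] at this
    | cons c cs =>
      obtain rfl : b = c := eq_of_scores_add_eq h
      rw [ih (Multiset.map_injective (add_left_injective b.size) (add_left_cancel h))]

end Block

/-! ### Non-tracking strings -/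

lemma nonTracking_cons (x : Bool) (w : List Bool) :
    NonTracking (x :: w) ↔ (∀ p ∈ trackPatterns, ¬ p <+: x :: w) ∧ NonTracking w := by
  simp only [NonTracking, List.infix_cons_iff, not_or]
  exact forall₂_and

lemma nonTracking_nil : NonTracking [] := by
  simp [NonTracking, trackPatterns]

lemma nonTracking_append_false (w : List Bool) :
    NonTracking (w ++ [false]) ↔ NonTracking w := by
  unfold NonTracking
  refine forall₂_congr fun p hp => not_congr ?_
  rw [List.infix_concat_iff, or_iff_right_iff_imp]
  rintro ⟨t, ht⟩
  have := congrArg List.getLast? ht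
  simp only [trackPatterns, List.mem_cons, List.not_mem_nil, or_false] at hp
  rcases hp with rfl | rfl | rfl | rfl <;> simp at this

/-- Final-loss non-tracking strings are the concatenations of block codes. -/
lemma exists_totalCode_iff (w : List Bool) :
    (∃ bs, Block.totalCode bs = w) ↔
      NonTracking w ∧ [false, false] <:+ false :: false :: w := by
  constructor
  · rintro ⟨bs, rfl⟩
    induction bs with
    | nil => exact ⟨nonTracking_nil, by simp [Block.totalCode]⟩
    | cons b bs ih =>
      obtain ⟨h1, h2⟩ := ih
      cases b <;>
        simp [Block.totalCode, Block.code, nonTracking_cons, trackPatterns, h1,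
          List.suffix_cons_iff] at h2 ⊢ <;> tauto
  · induction hn : w.length using Nat.strong_induction_on generalizing w with
    | _ n ih =>
    rintro ⟨h1, h2⟩
    have peel (b : Block) (v : List Bool) (hv : w = b.code ++ v) :
        ∃ bs, Block.totalCode bs = w := by
      subst hv
      have hlt : v.length < n := by
        rw [← hn, List.length_append, Block.length_code]
        cases b <;> simp [Block.size]
      obtain ⟨bs, rfl⟩ := ih _ hlt v rfl (by
        cases b <;>
          simp [Block.code, nonTracking_cons, List.suffix_cons_iff] at h1 h2 ⊢ <;> tauto)
      exact ⟨b :: bs, rfl⟩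
    match w, h1, h2, peel with
    | [], _, _, _ => exact ⟨[], rfl⟩
    | false :: v, _, _, peel => exact peel .one v rfl
    | true :: false :: false :: v, _, _, peel => exact peel .three v rfl
    | true :: true :: false :: false :: v, _, _, peel => exact peel .four v rfl
    | true :: false :: true :: false :: false :: v, _, _, peel => exact peel .five v rfl
    | true :: true :: true :: v, h, _, _ => simp [nonTracking_cons, trackPatterns] at h
    | true :: true :: false :: true :: v, h, _, _ => simp [nonTracking_cons, trackPatterns] at h
    | true :: false :: true :: true :: v, h, _, _ => simp [nonTracking_cons, trackPatterns] at h
    | true :: false :: true :: false :: true :: v, h, _, _ =>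
      simp [nonTracking_cons, trackPatterns] at h
    | [true], _, h, _ => simp [List.suffix_cons_iff] at h
    | [true, true], _, h, _ => simp [List.suffix_cons_iff] at h
    | [true, false], _, h, _ => simp [List.suffix_cons_iff] at h
    | [true, true, false], _, h, _ => simp [List.suffix_cons_iff] at h
    | [true, false, true], _, h, _ => simp [List.suffix_cons_iff] at h
    | [true, false, true, false], _, h, _ => simp [List.suffix_cons_iff] at h

lemma NTr_eq_card_blocks (k : ℕ) :
    NTr k = Nat.card {bs : List Block // Block.totalSize bs = k + 2} := by
  have hex (s : {s : List Bool // s.length = k ∧ NonTracking s}) :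
      ∃ bs, Block.totalCode bs = s.1 ++ [false] ++ [false] :=
    (exists_totalCode_iff _).2 ⟨by
      rw [nonTracking_append_false, nonTracking_append_false]; exact s.2.2,
      ⟨false :: false :: s.1, by simp⟩⟩
  choose f hf using hex
  refine Nat.card_congr (Equiv.ofBijective (fun s => ⟨f s, ?_⟩) ⟨?_, ?_⟩)
  · rw [← Block.length_totalCode, hf]
    simp [s.2.1]
  · intro s t h
    have h' := hf s
    rw [show f s = f t from congrArg Subtype.val h, hf t] at h'
    exact Subtype.ext (by simpa using h'.symm)
  · rintro ⟨bs, hbs⟩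
    obtain ⟨h1, t, ht⟩ := (exists_totalCode_iff _).1 ⟨bs, rfl⟩
    have hl := Block.length_totalCode bs
    have hc : Block.totalCode bs = t.drop 2 ++ [false] ++ [false] := by
      have h2 : 2 ≤ t.length := by
        have := congrArg List.length ht
        simp at this
        omega
      have := congrArg (List.drop 2) ht
      rw [List.drop_append_of_le_length h2] at this
      simpa using this.symm
    rw [hc, nonTracking_append_false, nonTracking_append_false] at h1
    refine ⟨⟨t.drop 2, ?_, h1⟩, Subtype.ext (Block.totalCode_injective ?_)⟩
    · rw [hc] at hl
      simp at hl ⊢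
      omega
    · exact (hf _).trans hc.symm

/-! ### Tournaments and their scores -/

section Basic

variable {α β γ δ : Type}

namespace IsTournament

variable {r : α → α → Prop}

lemma asymm (h : IsTournament r) {x y : α} (hxy : r x y) : ¬ r y x := by
  intro hyx
  by_cases hne : x = y
  · exact h.1 x (by rwa [← hne] at hxy)
  · rcases h.2 x y hne with h' | h'
    · exact h'.2 hyx
    · exact h'.2 hxy

lemma ne (h : IsTournament r) {x y : α} (hxy : r x y) : x ≠ y := by
  rintro rfl
  exact h.1 x hxy

lemma total (h : IsTournament r) {x y : α} (hne : x ≠ y) (hxy : ¬ r x y) : r y x := by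
  rcases h.2 x y hne with h' | h'
  · exact absurd h'.1 hxy
  · exact h'.1

lemma of_asymm_total (h1 : ∀ x y, r x y → ¬ r y x) (h2 : ∀ x y, x ≠ y → r x y ∨ r y x) :
    IsTournament r := by
  refine ⟨fun x hx => h1 x x hx hx, fun x y hne => ?_⟩
  rcases h2 x y hne with h | h
  · exact Or.inl ⟨h, h1 x y h⟩
  · exact Or.inr ⟨h, h1 y x h⟩

lemma onFun (h : IsTournament r) {f : β → α} (hf : Function.Injective f) :
    IsTournament fun x y => r (f x) (f y) :=
  ⟨fun _ => h.1 _, fun _ _ hne => h.2 _ _ (hf.ne hne)⟩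

lemma compT {A : α → α → Prop} {B : β → β → Prop} (hA : IsTournament A)
    (hB : IsTournament B) : IsTournament (compT A B) := by
  refine of_asymm_total ?_ ?_
  · rintro (_ | _) (_ | _) h
    · exact hA.asymm h
    · exact h.elim
    · exact not_false
    · exact hB.asymm h
  · rintro (x | x) (y | y) hne
    · exact or_iff_not_imp_left.2 (hA.total fun h => hne (h ▸ rfl))
    · exact Or.inr trivial
    · exact Or.inl trivial
    · exact or_iff_not_imp_left.2 (hB.total fun h => hne (h ▸ rfl))

end IsTournament

namespace Isomorphic

variable {r : α → α → Prop} {r' : β → β → Prop} {r'' : γ → γ → Prop}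

lemma symm (h : Isomorphic r r') : Isomorphic r' r := by
  obtain ⟨e, he⟩ := h
  exact ⟨e.symm, fun i j => by simp [he]⟩

lemma trans (h : Isomorphic r r') (h' : Isomorphic r' r'') : Isomorphic r r'' := by
  obtain ⟨e, he⟩ := h
  obtain ⟨f, hf⟩ := h'
  exact ⟨e.trans f, fun i j => by simp [he, hf]⟩

lemma compT {B : γ → γ → Prop} {B' : δ → δ → Prop} (h : Isomorphic r r')
    (h' : Isomorphic B B') : Isomorphic (compT r B) (compT r' B') := by
  obtain ⟨e, he⟩ := h
  obtain ⟨f, hf⟩ := h'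
  refine ⟨e.sumCongr f, ?_⟩
  rintro (x | x) (y | y) <;> simp [_root_.compT, he, hf]

lemma isTournament (h : Isomorphic r r') (hr : IsTournament r) : IsTournament r' := by
  obtain ⟨e, he⟩ := h.symm
  have := hr.onFun e.injective
  simpa only [← he] using this

lemma score_eq [Fintype α] [Fintype β] {e : α ≃ β} (he : ∀ i j, r i j ↔ r' (e i) (e j))
    (x : α) : score r' (e x) = score r x :=
  (Nat.card_congr (e.subtypeEquiv fun y => he x y)).symm

lemma scoreMultiset_eq [Fintype α] [Fintype β] (h : Isomorphic r r') :
    scoreMultiset r = scoreMultiset r' := by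
  obtain ⟨e, he⟩ := h
  unfold scoreMultiset
  rw [← Finset.map_univ_equiv e, Finset.map_val, Multiset.map_map]
  exact Multiset.map_congr rfl fun x _ => (score_eq he x).symm

lemma of_map [Fintype α] [Fintype β] (hr : IsTournament r) (hr' : IsTournament r')
    (hcard : Fintype.card α = Fintype.card β) (f : α → β)
    (hf : ∀ x y, r x y → r' (f x) (f y)) : Isomorphic r r' := by
  have hiff (x y : α) : r x y ↔ r' (f x) (f y) := by
    refine ⟨hf x y, fun h => ?_⟩
    by_contra hxy
    by_cases hne : x = y
    · subst hne
      exact hr'.1 _ h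
    · exact hr'.asymm h (hf _ _ (hr.total hne hxy))
  have hinj : Function.Injective f := by
    intro x y hxy
    by_contra hne
    rcases hr.2 x y hne with h | h
    · exact hr'.ne (hf _ _ h.1) hxy
    · exact hr'.ne (hf _ _ h.1) hxy.symm
  exact ⟨Equiv.ofBijective f
    ((Fintype.bijective_iff_injective_and_card f).2 ⟨hinj, hcard⟩), hiff⟩

lemma exists_transport (r : α → α → Prop) (e : α ≃ β) :
    ∃ r' : β → β → Prop, Isomorphic r r' :=
  ⟨fun x y => r (e.symm x) (e.symm y), e, fun i j => by simp⟩

end Isomorphic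

section Score

open scoped Classical in
lemma score_eq_card_filter [Fintype α] (r : α → α → Prop) (x : α) :
    score r x = (Finset.univ.filter (r x)).card := by
  rw [score, Nat.card_eq_fintype_card, Fintype.card_subtype]

lemma card_scoreMultiset [Fintype α] (r : α → α → Prop) :
    Multiset.card (scoreMultiset r) = Fintype.card α := by
  simp [scoreMultiset]

lemma IsTournament.score_lt_card [Fintype α] {r : α → α → Prop} (h : IsTournament r) (x : α) :
    score r x < Fintype.card α := by
  classical
  rw [score_eq_card_filter]
  exact Finset.card_lt_card (Finset.filter_ssubset.2 ⟨x, Finset.mem_univ x, h.1 x⟩)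

open scoped Classical in
/-- The out-degrees inside a subset of size `n` add up to `n * (n - 1) / 2`. -/
lemma IsTournament.two_mul_sum_inner [Fintype α] {r : α → α → Prop} (h : IsTournament r)
    (S : Finset α) :
    2 * ∑ x ∈ S, (S.filter (r x)).card + S.card = S.card * S.card := by
  have h1 : ∑ x ∈ S, (S.filter (r x)).card = ∑ x ∈ S, (S.filter fun y => r y x).card := by
    simp only [Finset.card_filter]
    exact Finset.sum_comm
  have h2 (x : α) (hx : x ∈ S) :
      (S.filter (r x)).card + (S.filter fun y => r y x).card + 1 = S.card := by
    rw [← Finset.card_erase_add_one hx, ← Finset.card_union_of_disjoint]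
    · congr 2
      ext y
      simp only [Finset.mem_union, Finset.mem_filter, Finset.mem_erase]
      constructor
      · rintro (⟨hy, hxy⟩ | ⟨hy, hxy⟩)
        · exact ⟨(h.ne hxy).symm, hy⟩
        · exact ⟨h.ne hxy, hy⟩
      · rintro ⟨hne, hy⟩
        by_cases hxy : r x y
        · exact Or.inl ⟨hy, hxy⟩
        · exact Or.inr ⟨hy, h.total hne.symm hxy⟩
    · rw [Finset.disjoint_filter]
      exact fun y _ hxy => h.asymm hxy
  have h3 := Finset.sum_congr rfl h2
  rw [Finset.sum_add_distrib, Finset.sum_add_distrib, ← h1] at h3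
  simp only [Finset.sum_const, smul_eq_mul, mul_one] at h3
  omega

lemma IsTournament.two_mul_sum_score [Fintype α] {r : α → α → Prop} (h : IsTournament r) :
    2 * ∑ x, score r x + Fintype.card α = Fintype.card α * Fintype.card α := by
  classical
  simpa only [score_eq_card_filter, Finset.card_univ] using h.two_mul_sum_inner Finset.univ

lemma score_compT_inl [Fintype α] [Fintype β] (A : α → α → Prop) (B : β → β → Prop) (x : α) :
    score (compT A B) (.inl x) = score A x := by
  refine (Nat.card_congr (Equiv.ofBijective (fun y => ⟨.inl y.1, y.2⟩) ⟨?_, ?_⟩)).symm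
  · intro y z h
    exact Subtype.ext (Sum.inl_injective (congrArg Subtype.val h))
  · rintro ⟨y | y, hy⟩
    · exact ⟨⟨y, hy⟩, rfl⟩
    · exact hy.elim

lemma score_compT_inr [Fintype α] [Fintype β] (A : α → α → Prop) (B : β → β → Prop) (x : β) :
    score (compT A B) (.inr x) = score B x + Fintype.card α := by
  have h : score (compT A B) (.inr x) = Nat.card (α ⊕ {y // B x y}) := by
    refine (Nat.card_congr (Equiv.ofBijective (Sum.elim (fun y => ⟨.inl y, trivial⟩)
      fun y => ⟨.inr y.1, y.2⟩) ⟨?_, ?_⟩)).symm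
    · rintro (y | y) (z | z) h
      · exact congrArg Sum.inl (Sum.inl_injective (congrArg Subtype.val h))
      · exact (Sum.inl_ne_inr (congrArg Subtype.val h)).elim
      · exact (Sum.inr_ne_inl (congrArg Subtype.val h)).elim
      · exact congrArg Sum.inr (Subtype.ext (Sum.inr_injective (congrArg Subtype.val h)))
    · rintro ⟨y | y, hy⟩
      · exact ⟨.inl y, rfl⟩
      · exact ⟨.inr ⟨y, hy⟩, rfl⟩
  rw [h, Nat.card_sum, Nat.card_eq_fintype_card (α := α), add_comm]
  rfl

lemma scoreMultiset_compT [Fintype α] [Fintype β] (A : α → α → Prop) (B : β → β → Prop) :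
    scoreMultiset (compT A B) =
      scoreMultiset A + (scoreMultiset B).map (· + Fintype.card α) := by
  simp only [scoreMultiset, ← Finset.univ_disjSum_univ, Finset.val_disjSum, Multiset.disjSum,
    Multiset.map_add, Multiset.map_map]
  simp [score_compT_inl, score_compT_inr]

/-- A tournament with a set that nothing leaves is a composition. -/
lemma IsTournament.isomorphic_compT {r : α → α → Prop} (h : IsTournament r) (p : α → Prop)
    (hp : ∀ x y, p x → ¬ p y → ¬ r x y) :
    Isomorphic
      (_root_.compT (fun x y : {x // p x} => r x y) fun x y : {x // ¬ p x} => r x y) r := by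
  classical
  refine ⟨Equiv.sumCompl p, ?_⟩
  rintro (⟨x, hx⟩ | ⟨x, hx⟩) (⟨y, hy⟩ | ⟨y, hy⟩)
  · simp [_root_.compT]
  · simpa [_root_.compT] using hp x y hx hy
  · simpa [_root_.compT] using
      h.total (by rintro rfl; exact hx hy) (hp y x hy hx)
  · simp [_root_.compT]

end Score

end Basic

/-! ### Tournaments determined by their scores -/

section Unique

variable {α β : Type} [Fintype α] [Fintype β]

/-- A tournament is unique if every tournament with the same score multiset on the same
vertices is isomorphic to it. -/
def UniqueTournament (r : α → α → Prop) : Prop :=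
  IsTournament r ∧ ∀ r' : α → α → Prop, IsTournament r' →
    scoreMultiset r' = scoreMultiset r → Isomorphic r r'

lemma Multiset.filter_lt_add_map {m : ℕ} {s t : Multiset ℕ} (hs : ∀ a ∈ s, a < m) :
    (s + t.map (· + m)).filter (· < m) = s := by
  rw [Multiset.filter_add, Multiset.filter_eq_self.2 hs, Multiset.filter_eq_nil.2, add_zero]
  simp

lemma Multiset.eq_of_add_map_eq {m : ℕ} {s s' t t' : Multiset ℕ} (hs : ∀ a ∈ s, a < m)
    (hs' : ∀ a ∈ s', a < m) (h : s + t.map (· + m) = s' + t'.map (· + m)) :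
    s = s' ∧ t = t' := by
  have h1 : s = s' := by
    rw [← Multiset.filter_lt_add_map (t := t) hs, h, Multiset.filter_lt_add_map hs']
  subst h1
  exact ⟨rfl, Multiset.map_injective (add_left_injective m) (add_left_cancel h)⟩

lemma IsTournament.lt_card_of_mem {r : α → α → Prop} (h : IsTournament r) :
    ∀ a ∈ scoreMultiset r, a < Fintype.card α := by
  simpa [scoreMultiset] using h.score_lt_card

namespace UniqueTournament

lemma of_isomorphic {r : α → α → Prop} {r' : β → β → Prop} (h : UniqueTournament r)
    (hi : Isomorphic r r') : UniqueTournament r' := by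
  refine ⟨hi.isTournament h.1, fun q hq hs => ?_⟩
  obtain ⟨e, -⟩ := id hi
  obtain ⟨q', hq'⟩ := Isomorphic.exists_transport q e.symm
  refine hi.symm.trans ((h.2 q' (hq'.isTournament hq) ?_).trans hq'.symm)
  rw [← hq'.scoreMultiset_eq, hs, hi.scoreMultiset_eq]

lemma left {A : α → α → Prop} {B : β → β → Prop} (h : UniqueTournament (compT A B))
    (hA : IsTournament A) (hB : IsTournament B) : UniqueTournament A := by
  refine ⟨hA, fun A' hA' hs => ?_⟩
  obtain ⟨e, he⟩ := h.2 (compT A' B) (hA'.compT hB) (by simp [scoreMultiset_compT, hs])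
  have hex (x : α) : ∃ y, e (.inl x) = .inl y := by
    have h1 := Isomorphic.score_eq he (.inl x)
    rw [score_compT_inl] at h1
    have h2 := hA.score_lt_card x
    cases hx : e (.inl x) with
    | inl y => exact ⟨y, rfl⟩
    | inr y =>
      rw [hx, score_compT_inr] at h1
      omega
  choose f hf using hex
  refine Isomorphic.of_map hA hA' rfl f fun x y hxy => ?_
  have := (he (.inl x) (.inl y)).1 hxy
  rwa [hf, hf] at this

lemma right {A : α → α → Prop} {B : β → β → Prop} (h : UniqueTournament (compT A B))
    (hA : IsTournament A) (hB : IsTournament B) : UniqueTournament B := by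
  refine ⟨hB, fun B' hB' hs => ?_⟩
  obtain ⟨e, he⟩ := h.2 (compT A B') (hA.compT hB') (by simp [scoreMultiset_compT, hs])
  have hex (x : β) : ∃ y, e (.inr x) = .inr y := by
    have h1 := Isomorphic.score_eq he (.inr x)
    rw [score_compT_inr] at h1
    cases hx : e (.inr x) with
    | inr y => exact ⟨y, rfl⟩
    | inl y =>
      rw [hx, score_compT_inl] at h1
      have h2 := hA.score_lt_card y
      omega
  choose f hf using hex
  refine Isomorphic.of_map hB hB' rfl f fun x y hxy => ?_
  have := (he (.inr x) (.inr y)).1 hxy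
  rwa [hf, hf] at this

lemma compT {A : α → α → Prop} {B : β → β → Prop} (hA : UniqueTournament A)
    (hB : UniqueTournament B) : UniqueTournament (compT A B) := by
  classical
  refine ⟨hA.1.compT hB.1, fun r hr hs => ?_⟩
  set m := Fintype.card α with hm
  set S : Finset (α ⊕ β) := Finset.univ.filter fun x => score r x < m with hS
  rw [scoreMultiset_compT] at hs
  have hmap : S.val.map (score r) = scoreMultiset A := by
    rw [← Multiset.filter_lt_add_map (t := scoreMultiset B) hA.1.lt_card_of_mem, ← hs,
      scoreMultiset, Multiset.filter_map]
    rfl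
  have hcard : S.card = m := by
    rw [hm, ← card_scoreMultiset A, ← hmap, Multiset.card_map, Finset.card_def]
  have hsum : ∑ x ∈ S, score r x = ∑ x, score A x := congrArg Multiset.sum hmap
  have hsum' : ∑ x ∈ S, (S.filter (r x)).card = ∑ x ∈ S, score r x := by
    have h1 := hA.1.two_mul_sum_score
    have h2 := hr.two_mul_sum_inner S
    rw [← hm] at h1
    rw [hcard] at h2
    rw [hsum]
    omega
  have hle (x : α ⊕ β) : S.filter (r x) ⊆ Finset.univ.filter (r x) :=
    Finset.filter_subset_filter _ (Finset.subset_univ _)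
  have hclosed (x y : α ⊕ β) (hx : score r x < m) (hy : ¬ score r y < m) : ¬ r x y := by
    intro hxy
    have h1 := (Finset.sum_eq_sum_iff_of_le fun x _ => by
      rw [score_eq_card_filter]; exact Finset.card_le_card (hle x)).1 hsum' x (by simp [hS, hx])
    rw [score_eq_card_filter] at h1
    have h2 := Finset.eq_of_subset_of_card_le (hle x) h1.ge
    have h3 : y ∈ S.filter (r x) := by
      rw [h2]
      simpa using hxy
    simp [hS, hy] at h3
  have hiso := hr.isomorphic_compT (fun x => score r x < m) hclosed
  have hc1 : Fintype.card {x // score r x < m} = Fintype.card α := by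
    rw [Fintype.card_subtype]
    exact hcard
  have hc2 : Fintype.card {x // ¬ score r x < m} = Fintype.card β := by
    rw [Fintype.card_subtype_compl, hc1, Fintype.card_sum, Nat.add_sub_cancel_left]
  obtain ⟨A', hA'⟩ := Isomorphic.exists_transport
    (fun x y : {x // score r x < m} => r x y) (Fintype.equivOfCardEq hc1)
  obtain ⟨B', hB'⟩ := Isomorphic.exists_transport
    (fun x y : {x // ¬ score r x < m} => r x y) (Fintype.equivOfCardEq hc2)
  have hA't := hA'.isTournament (hr.onFun Subtype.val_injective)
  have hB't := hB'.isTournament (hr.onFun Subtype.val_injective)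
  have hiso' := hiso.symm.trans (hA'.compT hB')
  rw [hiso'.scoreMultiset_eq, scoreMultiset_compT] at hs
  obtain ⟨h1, h2⟩ := Multiset.eq_of_add_map_eq hA't.lt_card_of_mem hA.1.lt_card_of_mem hs
  exact ((hA.2 A' hA't h1).compT (hB.2 B' hB't h2)).trans hiso'.symm

end UniqueTournament

end Unique

/-! ### Reversing a cyclic triangle -/

section Flip

variable {α : Type}

/-- `r x y` for vertices forming the cyclic triangle `a → b → c → a`. -/
def CyclicTriple (r : α → α → Prop) (a b c : α) : Prop :=
  r a b ∧ r b c ∧ r c a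

lemma CyclicTriple.rotate {r : α → α → Prop} {a b c : α} (h : CyclicTriple r a b c) :
    CyclicTriple r b c a :=
  ⟨h.2.1, h.2.2, h.1⟩

/-- The tournament obtained by reversing all edges among `a`, `b`, `c`. -/
def flipTriple (r : α → α → Prop) (a b c : α) : α → α → Prop := fun x y =>
  ((x = a ∨ x = b ∨ x = c) ∧ (y = a ∨ y = b ∨ y = c) ∧ r y x) ∨
    (¬ ((x = a ∨ x = b ∨ x = c) ∧ (y = a ∨ y = b ∨ y = c)) ∧ r x y)

variable {r : α → α → Prop} {a b c x y : α}

lemma flipTriple_rotate : flipTriple r b c a = flipTriple r a b c := by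
  funext x y
  unfold flipTriple
  grind

lemma flipTriple_iff_of_left (hx : x ≠ a ∧ x ≠ b ∧ x ≠ c) :
    flipTriple r a b c x y ↔ r x y := by
  unfold flipTriple
  grind

lemma flipTriple_iff_of_right (hy : y ≠ a ∧ y ≠ b ∧ y ≠ c) :
    flipTriple r a b c x y ↔ r x y := by
  unfold flipTriple
  grind

lemma flipTriple_left : flipTriple r a b c a y ↔
    (y = a ∧ r y a) ∨ (y = b ∧ r y a) ∨ (y = c ∧ r y a) ∨
      (y ≠ a ∧ y ≠ b ∧ y ≠ c ∧ r a y) := by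
  unfold flipTriple
  grind

lemma IsTournament.flipTriple (hr : IsTournament r) : IsTournament (flipTriple r a b c) := by
  refine .of_asymm_total ?_ ?_
  · intro x y
    have h1 (x y : α) : r x y → ¬ r y x := hr.asymm
    unfold _root_.flipTriple
    grind
  · intro x y hne
    have h1 := hr.total hne
    unfold _root_.flipTriple
    grind

lemma CyclicTriple.flipTriple (h : CyclicTriple r a b c) :
    CyclicTriple (flipTriple r a b c) b a c := by
  obtain ⟨h1, h2, h3⟩ := h
  unfold CyclicTriple _root_.flipTriple
  grind

lemma CyclicTriple.ne (hr : IsTournament r) (h : CyclicTriple r a b c) :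
    a ≠ b ∧ b ≠ c ∧ c ≠ a :=
  ⟨hr.ne h.1, hr.ne h.2.1, hr.ne h.2.2⟩

lemma flipTriple_iff_swap [DecidableEq α] (hr : IsTournament r) (h : CyclicTriple r a b c) :
    flipTriple r a b c a y ↔ r a (Equiv.swap b c y) := by
  have hne := h.ne hr
  have hasymm (x y : α) : r x y → ¬ r y x := hr.asymm
  obtain ⟨hab, hbc, hca⟩ := h
  by_cases hb : y = b
  · subst hb
    rw [Equiv.swap_apply_left]
    simp only [flipTriple_left]
    grind
  by_cases hc : y = c
  · subst hc
    rw [Equiv.swap_apply_right]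
    simp only [flipTriple_left]
    grind
  rw [Equiv.swap_apply_of_ne_of_ne hb hc]
  simp only [flipTriple_left]
  grind

lemma exists_perm_flipTriple (hr : IsTournament r) (h : CyclicTriple r a b c) (x : α) :
    ∃ σ : Equiv.Perm α, (∀ y, flipTriple r a b c x y ↔ r x (σ y)) ∧
      ∀ y, σ y = y ∨ ((y = a ∨ y = b ∨ y = c) ∧ (σ y = a ∨ σ y = b ∨ σ y = c)) := by
  classical
  have key (p q y : α) : Equiv.swap p q y = y ∨
      ((y = p ∨ y = q) ∧ (Equiv.swap p q y = p ∨ Equiv.swap p q y = q)) := by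
    rw [Equiv.swap_apply_def]
    grind
  by_cases ha : x = a
  · subst ha
    refine ⟨Equiv.swap b c, fun y => flipTriple_iff_swap hr h, fun y => ?_⟩
    have := key b c y
    tauto
  by_cases hb : x = b
  · subst hb
    refine ⟨Equiv.swap c a, fun y => ?_, fun y => ?_⟩
    · rw [← flipTriple_rotate]
      exact flipTriple_iff_swap hr h.rotate
    · have := key c a y
      tauto
  by_cases hc : x = c
  · subst hc
    refine ⟨Equiv.swap a b, fun y => ?_, fun y => ?_⟩
    · rw [← flipTriple_rotate, ← flipTriple_rotate]
      exact flipTriple_iff_swap hr h.rotate.rotate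
    · have := key a b y
      tauto
  exact ⟨1, fun y => flipTriple_iff_of_left ⟨ha, hb, hc⟩, fun y => Or.inl rfl⟩

variable [Fintype α]

lemma score_flipTriple (hr : IsTournament r) (h : CyclicTriple r a b c) :
    score (flipTriple r a b c) = score r := by
  funext x
  obtain ⟨σ, hσ, -⟩ := exists_perm_flipTriple hr h x
  exact Nat.card_congr (σ.subtypeEquiv hσ)

open scoped Classical in
/-- The number of vertices of the same score beaten by `x`. -/
noncomputable def innerScore (r : α → α → Prop) (x : α) : ℕ :=
  (Finset.univ.filter fun y => r x y ∧ score r y = score r x).card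

open scoped Classical in
/-- The number of vertices of a different score beaten by `x`. -/
noncomputable def outerScore (r : α → α → Prop) (x : α) : ℕ :=
  (Finset.univ.filter fun y => r x y ∧ score r y ≠ score r x).card

lemma innerScore_add_outerScore (r : α → α → Prop) (x : α) :
    innerScore r x + outerScore r x = score r x := by
  classical
  rw [score_eq_card_filter, innerScore, outerScore, ← Finset.filter_filter,
    ← Finset.filter_filter, Finset.card_filter_add_card_filter_not]

lemma innerScore_flipTriple_of_score_eq (hr : IsTournament r) (h : CyclicTriple r a b c)
    (hab : score r a = score r b) (hbc : score r b = score r c) :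
    innerScore (flipTriple r a b c) = innerScore r := by
  classical
  funext x
  obtain ⟨σ, hσ, hσ'⟩ := exists_perm_flipTriple hr h x
  unfold innerScore
  rw [score_flipTriple hr h]
  refine Finset.card_equiv σ fun y => ?_
  have hs : score r (σ y) = score r y := by
    rcases hσ' y with hy | ⟨hy, hy'⟩
    · rw [hy]
    · rcases hy with hy | hy | hy <;> rcases hy' with hy' | hy' | hy' <;> rw [hy', hy] <;> omega
  simp [hσ, hs]

namespace UniqueTournament

lemma flipTriple_isomorphic (hr : UniqueTournament r) (h : CyclicTriple r a b c) :
    Isomorphic r (flipTriple r a b c) :=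
  hr.2 _ hr.1.flipTriple (by unfold scoreMultiset; rw [score_flipTriple hr.1 h])

lemma flipTriple (hr : UniqueTournament r) (h : CyclicTriple r a b c) :
    UniqueTournament (flipTriple r a b c) :=
  hr.of_isomorphic (hr.flipTriple_isomorphic h)

/-- In a unique tournament no cyclic triangle has three different scores. -/
lemma score_eq_of_cyclicTriple (hr : UniqueTournament r) (h : CyclicTriple r a b c) :
    score r a = score r b ∨ score r b = score r c ∨ score r c = score r a := by
  classical
  by_contra! hne
  obtain ⟨hab, hbc, hca⟩ := hne
  obtain ⟨e, he⟩ := hr.flipTriple_isomorphic h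
  have hs (x : α) : score r (e x) = score r x := by
    have := Isomorphic.score_eq he x
    rwa [score_flipTriple hr.1 h] at this
  set S : Finset (α × α) := Finset.univ.filter fun p =>
    r p.1 p.2 ∧ score r p.1 = score r a ∧ score r p.2 = score r b with hS
  set S' : Finset (α × α) := Finset.univ.filter fun p =>
    _root_.flipTriple r a b c p.1 p.2 ∧ score r p.1 = score r a ∧ score r p.2 = score r b with hS'
  have hcard : S.card = S'.card := Finset.card_equiv (e.prodCongr e) fun p => by
    simp [hS, hS', he, hs]
  have hsub : S' ⊂ S := by
    refine Finset.ssubset_iff_of_subset ?_ |>.2 ⟨(a, b), ?_, ?_⟩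
    · rintro ⟨x, y⟩
      have := hr.1.asymm h.1
      simp only [hS, hS', Finset.mem_filter, Finset.mem_univ, true_and, _root_.flipTriple]
      grind
    · simp [hS, h.1]
    · have := hr.1.asymm h.1
      simpa [hS', _root_.flipTriple] using this
  exact (Finset.card_lt_card hsub).ne' hcard

/-- A cyclic triangle with exactly two vertices of the same score forces their inner
scores. -/
lemma innerScore_eq_of_cyclicTriple (hr : UniqueTournament r) (h : CyclicTriple r a b c)
    (hab : score r a = score r b) (hca : score r c ≠ score r a) :
    innerScore r a = innerScore r b + 1 := by
  classical
  obtain ⟨e, he⟩ := hr.flipTriple_isomorphic h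
  have hs (x : α) : score r (e x) = score r x := by
    have := Isomorphic.score_eq he x
    rwa [score_flipTriple hr.1 h] at this
  have hne := h.ne hr.1
  have hba := hr.1.asymm h.1
  have hasymm (x y : α) : r x y → ¬ r y x := hr.1.asymm
  set d := innerScore r with hd
  set d' := innerScore (_root_.flipTriple r a b c) with hd'
  have hsum : ∑ x, (d x) ^ 2 = ∑ x, (d' x) ^ 2 := by
    rw [← e.sum_comp fun x => (d' x) ^ 2]
    refine Finset.sum_congr rfl fun x _ => ?_
    congr 1
    refine Finset.card_equiv e fun y => ?_
    simp [he, hs, score_flipTriple hr.1 h]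
  have h1 : d a = d' a + 1 := by
    rw [hd, hd', innerScore, innerScore, score_flipTriple hr.1 h,
      ← Finset.card_insert_of_notMem (a := b)]
    · congr 1
      ext y
      simp only [Finset.mem_filter, Finset.mem_univ, true_and, Finset.mem_insert, flipTriple_left]
      grind [CyclicTriple]
    · simp [_root_.flipTriple, hba]
  have h2 : d' b = d b + 1 := by
    rw [hd, hd', innerScore, innerScore, score_flipTriple hr.1 h,
      ← Finset.card_insert_of_notMem (a := a)]
    · congr 1
      ext y
      rw [← flipTriple_rotate]
      simp only [Finset.mem_filter, Finset.mem_univ, true_and, Finset.mem_insert, flipTriple_left]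
      grind [CyclicTriple]
    · simp [hba]
  have h3 (x : α) (hxa : x ≠ a) (hxb : x ≠ b) : d' x = d x := by
    rw [hd, hd', innerScore, innerScore, score_flipTriple hr.1 h]
    congr 1
    ext y
    simp only [Finset.mem_filter, Finset.mem_univ, true_and]
    by_cases hxc : x = c
    · subst hxc
      rw [← flipTriple_rotate, ← flipTriple_rotate, flipTriple_left]
      grind
    · rw [flipTriple_iff_of_left ⟨hxa, hxb, hxc⟩]
  have hmem : b ∈ Finset.univ.erase a := by simp [hne.1.symm]
  rw [← Finset.add_sum_erase _ _ (Finset.mem_univ a), ← Finset.add_sum_erase _ _ hmem,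
    ← Finset.add_sum_erase _ (fun x => (d' x) ^ 2) (Finset.mem_univ a),
    ← Finset.add_sum_erase _ (fun x => (d' x) ^ 2) hmem,
    Finset.sum_congr (g := fun x => (d' x) ^ 2) rfl fun x hx => by
      simp only [Finset.mem_erase] at hx
      rw [h3 x hx.2.1 hx.1]] at hsum
  rw [h1, h2] at hsum
  rw [h1]
  nlinarith

end UniqueTournament

end Flip

/-! ### Strong unique tournaments have at most two scores -/

section Strong

variable {α : Type}

/-- A tournament is strong if some edge leaves every proper nonempty set of vertices. -/
def StrongTournament (r : α → α → Prop) : Prop :=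
  ∀ X : Set α, X.Nonempty → Xᶜ.Nonempty → ∃ x ∈ X, ∃ y ∉ X, r x y

variable [Fintype α] {r : α → α → Prop}

open scoped Classical in
lemma IsTournament.exists_two_path (hr : IsTournament r) (P : α → Prop) {u v : α} (huv : r u v)
    (hv : P v) (hcard : (Finset.univ.filter fun y => r u y ∧ P y).card ≤
      (Finset.univ.filter fun y => r v y ∧ P y).card) : ∃ t, P t ∧ r v t ∧ r t u := by
  by_contra! h
  refine hcard.not_gt (Finset.card_lt_card (Finset.ssubset_iff_of_subset ?_ |>.2 ⟨v, ?_, ?_⟩))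
  · intro y hy
    simp only [Finset.mem_filter, Finset.mem_univ, true_and] at hy ⊢
    refine ⟨hr.total ?_ (h y hy.2 hy.1), hy.2⟩
    rintro rfl
    exact hr.asymm huv hy.1
  · simp [huv, hv]
  · simp [hr.1]

lemma IsTournament.exists_cyclicTriple (hr : IsTournament r) {u v : α} (huv : r u v)
    (hle : score r u ≤ score r v) : ∃ t, CyclicTriple r u v t := by
  obtain ⟨t, -, h⟩ := hr.exists_two_path (fun _ => True) huv trivial (by
    rw [score_eq_card_filter, score_eq_card_filter] at hle
    convert hle <;> simp)
  exact ⟨t, huv, h⟩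

namespace UniqueTournament

lemma iff_of_cyclicTriple (hr : UniqueTournament r) {a b c z : α} (h : CyclicTriple r a b c)
    (hab : score r a ≠ score r b) (hza : score r z ≠ score r a) (hzb : score r z ≠ score r b) :
    r z a ↔ r z b := by
  have hzc : z ≠ c := by
    rintro rfl
    have := hr.score_eq_of_cyclicTriple h
    tauto
  have hza' : z ≠ a := by rintro rfl; exact hza rfl
  have hzb' : z ≠ b := by rintro rfl; exact hzb rfl
  constructor
  · intro hz
    by_contra hnz
    have := hr.score_eq_of_cyclicTriple ⟨h.1, hr.1.total hzb' hnz, hz⟩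
    tauto
  · intro hz
    by_contra hnz
    have hz' := hr.1.total hza' hnz
    have := (hr.flipTriple h).score_eq_of_cyclicTriple (a := b) (b := a) (c := z)
      ⟨h.flipTriple.1, (flipTriple_iff_of_right ⟨hza', hzb', hzc⟩).2 hz',
        (flipTriple_iff_of_left ⟨hza', hzb', hzc⟩).2 hz⟩
    rw [score_flipTriple hr.1 h] at this
    tauto

/-- In a transitive triangle with three different scores, whatever beats the top vertex
beats the bottom vertex. -/
lemma rel_of_transitive (hr : UniqueTournament r) {x y z t : α} (hxy : r x y) (hyz : r y z)
    (hxz : r x z) (h1 : score r x ≠ score r y) (h2 : score r y ≠ score r z)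
    (h3 : score r x ≠ score r z) (htx : r t x) : r t z := by
  by_contra htz
  have hzt : r z t := by
    refine hr.1.total ?_ htz
    rintro rfl
    exact hr.1.asymm hxz htx
  exact hr.1.asymm hxy ((hr.iff_of_cyclicTriple ⟨hxz, hzt, htx⟩ h3 h1.symm h2).2 hyz)

lemma score_le_of_transitive (hr : UniqueTournament r) {x y z : α} (hxy : r x y) (hyz : r y z)
    (hxz : r x z) (h1 : score r x ≠ score r y) (h2 : score r y ≠ score r z)
    (h3 : score r x ≠ score r z) : score r z ≤ score r x := by
  classical
  rw [score_eq_card_filter, score_eq_card_filter]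
  refine Finset.card_le_card fun t ht => ?_
  simp only [Finset.mem_filter, Finset.mem_univ, true_and] at ht ⊢
  by_contra hxt
  have htx : r t x := by
    refine hr.1.total ?_ hxt
    rintro rfl
    exact hr.1.asymm hxz ht
  exact hr.1.asymm ht (hr.rel_of_transitive hxy hyz hxz h1 h2 h3 htx)

theorem exists_two_scores [Nonempty α] (hr : UniqueTournament r) (hs : StrongTournament r) :
    ∃ p q, ∀ x, score r x = p ∨ score r x = q := by
  obtain ⟨m, hm⟩ := Finite.exists_min (score r)
  have hdom (u v z : α) (hu : score r u = score r m) (huv : r u v)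
      (hvu : score r v ≠ score r m) (hzu : score r z ≠ score r m)
      (hzv : score r z ≠ score r v) : r z u ∧ r z v := by
    obtain ⟨t, ht⟩ := hr.1.exists_cyclicTriple huv (hu ▸ hm v)
    have hiff := hr.iff_of_cyclicTriple (z := z) ht (by omega) (by omega) hzv
    by_contra hn
    have h1 : ¬ r z u := by tauto
    have h2 : ¬ r z v := by tauto
    have h3 := hr.score_le_of_transitive huv
      (hr.1.total (by rintro rfl; exact hzv rfl) h2)
      (hr.1.total (by rintro rfl; exact hzu hu) h1) (by omega) (by omega) (by omega)
    have := hm z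
    omega
  by_cases h : ∃ x, score r x ≠ score r m
  swap
  · exact ⟨score r m, score r m, by simpa using h⟩
  obtain ⟨u, hu, v, hv, huv⟩ := hs {x | score r x = score r m} ⟨m, rfl⟩ h
  refine ⟨score r m, score r v, ?_⟩
  by_contra! hH
  obtain ⟨y, hy, z, hz, hyz⟩ := hs {x | score r x = score r m ∨ score r x = score r v}
    ⟨m, Or.inl rfl⟩ (by simpa [Set.Nonempty] using hH)
  simp only [Set.mem_ofPred_eq, not_or] at hu hv hy hz
  obtain ⟨hzu, hzv⟩ := hdom u v z hu huv hv hz.1 hz.2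
  rcases hy with hy | hy
  · exact hr.1.asymm hzv (hdom y z v hy hyz hz.1 hv (Ne.symm hz.2)).2
  have hyv : r y v := hr.rel_of_transitive hzu huv hzv (by omega) (by omega) (by omega) hyz
  obtain ⟨t, ht⟩ := hr.1.exists_cyclicTriple hyv hy.le
  have htm : score r t ≠ score r m := by
    intro htm
    have h1 := hr.iff_of_cyclicTriple (z := z) ht.rotate (by omega) (by omega) (by omega)
    have h2 := hr.iff_of_cyclicTriple (z := z) ht.rotate.rotate (by omega) (by omega) (by omega)
    exact hr.1.asymm hyz (h2.1 (h1.1 hzv))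
  have htv : score r t = score r v := by
    by_contra htv
    exact hr.1.asymm ht.2.1 (hdom u v t hu huv hv htm htv).2
  have huT : u ≠ y ∧ u ≠ v ∧ u ≠ t := by
    refine ⟨?_, ?_, ?_⟩ <;> rintro rfl <;> omega
  have hzT : z ≠ y ∧ z ≠ v ∧ z ≠ t := by
    refine ⟨?_, ?_, ?_⟩ <;> rintro rfl <;> omega
  refine (hr.flipTriple ht).1.asymm ht.flipTriple.1
    ((hr.flipTriple ht).rel_of_transitive (x := z) (y := u) ((flipTriple_iff_of_left hzT).2 hzu)
      ((flipTriple_iff_of_left huT).2 huv) ((flipTriple_iff_of_left hzT).2 hzv) ?_ ?_ ?_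
      ((flipTriple_iff_of_right hzT).2 hyz)) <;>
    rw [score_flipTriple hr.1 ht] <;> omega

/-! ### Score classes have at most two elements -/

lemma innerScore_le_add_one (hr : UniqueTournament r) {u v : α} (huv : score r u = score r v) :
    innerScore r u ≤ innerScore r v + 1 := by
  classical
  by_contra! hlt
  have hu := innerScore_add_outerScore r u
  have hv := innerScore_add_outerScore r v
  obtain ⟨w, hw, hwu⟩ : ∃ w, (r v w ∧ score r w ≠ score r v) ∧
      ¬ (r u w ∧ score r w ≠ score r v) := by
    by_contra! hsub
    have : outerScore r v ≤ outerScore r u := by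
      unfold outerScore
      rw [huv]
      exact Finset.card_le_card (Finset.monotone_filter_right _ fun w _ hw => hsub w hw)
    omega
  have hwu : r w u := by
    refine hr.1.total ?_ fun h => hwu ⟨h, hw.2⟩
    rintro rfl
    exact hw.2 huv
  by_cases h : r u v
  · have := hr.innerScore_eq_of_cyclicTriple ⟨h, hw.1, hwu⟩ huv (by rw [huv]; exact hw.2)
    omega
  have h : r v u := hr.1.total (by rintro rfl; omega) h
  obtain ⟨t, ht, hut, htv⟩ := hr.1.exists_two_path (fun y => score r y = score r u) h rfl (by
    have : innerScore r v ≤ innerScore r u := by omega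
    unfold innerScore at this
    rw [← huv] at this
    convert this)
  have hT : CyclicTriple r v u t := ⟨h, hut, htv⟩
  have hwT : w ≠ v ∧ w ≠ u ∧ w ≠ t := by
    refine ⟨?_, ?_, ?_⟩ <;> rintro rfl
    · exact hw.2 rfl
    · exact hw.2 huv
    · exact hw.2 (ht.trans huv)
  have := (hr.flipTriple hT).innerScore_eq_of_cyclicTriple (a := u) (b := v) (c := w)
    ⟨hT.flipTriple.1, (flipTriple_iff_of_right hwT).2 hw.1, (flipTriple_iff_of_left hwT).2 hwu⟩
    (by rwa [score_flipTriple hr.1 hT]) (by rw [score_flipTriple hr.1 hT, huv]; exact hw.2)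
  rw [innerScore_flipTriple_of_score_eq hr.1 hT huv.symm ht.symm] at this
  omega

lemma rel_of_innerScore_le (hr : UniqueTournament r) {u v w : α} (huv : r u v)
    (hs : score r u = score r v) (hle : innerScore r u ≤ innerScore r v)
    (hw : score r w ≠ score r u) (hwu : r w u) : r w v := by
  by_contra h
  have hvw : r v w := by
    refine hr.1.total ?_ h
    rintro rfl
    exact hw hs.symm
  have := hr.innerScore_eq_of_cyclicTriple ⟨huv, hvw, hwu⟩ hs hw
  omega

open scoped Classical in
lemma outer_subset (hr : UniqueTournament r) {u v : α} (huv : r u v)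
    (hs : score r u = score r v) (hle : innerScore r u ≤ innerScore r v) :
    (Finset.univ.filter fun y => r v y ∧ score r y ≠ score r v) ⊆
      Finset.univ.filter fun y => r u y ∧ score r y ≠ score r u := by
  refine Finset.monotone_filter_right _ fun w _ hw => ?_
  rw [hs]
  refine ⟨hr.1.total ?_ fun h => ?_, hw.2⟩
  · rintro rfl
    exact hw.2 hs
  · exact hr.1.asymm hw.1 (hr.rel_of_innerScore_le huv hs hle (hs ▸ hw.2) h)

lemma rel_iff_of_innerScore_eq (hr : UniqueTournament r) {u v w : α}
    (hs : score r u = score r v) (hi : innerScore r u = innerScore r v)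
    (hw : score r w ≠ score r u) : r w u ↔ r w v := by
  classical
  have key (u v : α) (huv : r u v) (hs : score r u = score r v)
      (hi : innerScore r u = innerScore r v) (hw : score r w ≠ score r u) : r w u ↔ r w v := by
    refine ⟨hr.rel_of_innerScore_le huv hs hi.le hw, fun hwv => ?_⟩
    have hu' := innerScore_add_outerScore r u
    have hv' := innerScore_add_outerScore r v
    have h1 := Finset.eq_of_subset_of_card_le (hr.outer_subset huv hs hi.le)
      (show outerScore r u ≤ outerScore r v by omega)
    by_contra h
    have huw : r u w := hr.1.total (by rintro rfl; exact hw rfl) h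
    have h2 : w ∈ Finset.univ.filter fun y => r v y ∧ score r y ≠ score r v := by
      rw [h1]
      simp [huw, hw]
    simp only [Finset.mem_filter, Finset.mem_univ, true_and] at h2
    exact hr.1.asymm hwv h2.1
  by_cases hne : u = v
  · rw [hne]
  by_cases huv : r u v
  · exact key u v huv hs hi hw
  · exact (key v u (hr.1.total hne huv) hs.symm hi.symm (hs ▸ hw)).symm

end UniqueTournament

end Strong

section ScoreClass

variable {α : Type} [Fintype α] {r : α → α → Prop}

namespace UniqueTournament

open scoped Classical in
theorem card_scoreClass_le_two (hr : UniqueTournament r) (hs : StrongTournament r) {a b : ℕ}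
    (hab : ∀ x, score r x = a ∨ score r x = b) (hb : ∃ x, score r x ≠ a) :
    (Finset.univ.filter fun x => score r x = a).card ≤ 2 := by
  by_contra! hp
  set A := Finset.univ.filter fun x => score r x = a with hA
  have memA (x : α) : x ∈ A ↔ score r x = a := by simp [hA]
  have houter (w : α) (hw : score r w ≠ a) : outerScore r w = (A.filter (r w)).card := by
    rw [outerScore]
    congr 1
    ext y
    simp only [Finset.mem_filter, Finset.mem_univ, true_and, memA]
    have := hab w
    have := hab y
    refine ⟨fun h => ⟨by omega, h.1⟩, fun h => ⟨h.2, by omega⟩⟩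
  have hinner (x : α) (hx : score r x = a) : innerScore r x = (A.filter (r x)).card := by
    rw [innerScore]
    congr 1
    ext y
    simp only [Finset.mem_filter, Finset.mem_univ, true_and, memA, hx]
    tauto
  have hrange (w w' : α) (hw : score r w ≠ a) (hw' : score r w' ≠ a) :
      (A.filter (r w')).card ≤ (A.filter (r w)).card + 1 := by
    rw [← houter w hw, ← houter w' hw']
    have h1 := hab w
    have h2 := hab w'
    have h3 := hr.innerScore_le_add_one (u := w) (v := w') (by omega)
    have h4 := innerScore_add_outerScore r w
    have h5 := innerScore_add_outerScore r w'
    omega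
  obtain ⟨x₀, hx₀⟩ : A.Nonempty := Finset.card_pos.1 (by omega)
  by_cases hconst : ∀ u ∈ A, ∀ v ∈ A, innerScore r u = innerScore r v
  · have hunif (u v w : α) (hu : u ∈ A) (hv : v ∈ A) (hw : w ∉ A) : r w u ↔ r w v := by
      have h1 := (memA u).1 hu
      have h2 := (memA v).1 hv
      rw [memA] at hw
      exact hr.rel_iff_of_innerScore_eq (by omega) (hconst u hu v hv) (by omega)
    have hb' : ((A : Set α)ᶜ).Nonempty := by
      obtain ⟨x, hx⟩ := hb
      exact ⟨x, by simpa [memA] using hx⟩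
    obtain ⟨u, hu, w, hw, huw⟩ := hs A ⟨x₀, hx₀⟩ hb'
    obtain ⟨w', hw', v, hv, hwv⟩ := hs (A : Set α)ᶜ hb' (by rw [compl_compl]; exact ⟨x₀, hx₀⟩)
    simp only [Set.mem_compl_iff, Finset.mem_coe, not_not] at hu hw hw' hv
    have h1 : A.filter (r w) = ∅ := by
      rw [Finset.filter_eq_empty_iff]
      exact fun x hx h => hr.1.asymm huw ((hunif x u w hx hu hw).1 h)
    have h2 : A.filter (r w') = A :=
      Finset.filter_true_of_mem fun x hx => (hunif v x w' hv hx hw').1 hwv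
    have := hrange w w' (mt (memA w).2 hw) (mt (memA w').2 hw')
    rw [h1, h2, Finset.card_empty] at this
    omega
  obtain ⟨u, hu, v, hv, huv⟩ : ∃ u ∈ A, ∃ v ∈ A, innerScore r u < innerScore r v := by
    push Not at hconst
    obtain ⟨u, hu, v, hv, huv⟩ := hconst
    rcases lt_or_gt_of_ne huv with h | h
    · exact ⟨u, hu, v, hv, h⟩
    · exact ⟨v, hv, u, hu, h⟩
  have hrangeA (x y : α) (hx : x ∈ A) (hy : y ∈ A) : innerScore r x ≤ innerScore r y + 1 :=
    hr.innerScore_le_add_one (by rw [(memA x).1 hx, (memA y).1 hy])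
  set ρ := innerScore r u with hρ
  have hvρ : innerScore r v = ρ + 1 := by
    have := hrangeA v u hv hu
    omega
  have hval (x : α) (hx : x ∈ A) : innerScore r x = ρ ∨ innerScore r x = ρ + 1 := by
    have h1 := hrangeA x u hx hu
    have h2 := hrangeA v x hv hx
    omega
  set A₁ := A.filter fun x => innerScore r x = ρ with hA₁
  set A₂ := A.filter fun x => ¬ innerScore r x = ρ with hA₂
  have hcard : A₁.card + A₂.card = A.card := Finset.card_filter_add_card_filter_not _
  have hu₁ : u ∈ A₁ := by simp [hA₁, hu, hρ]
  have hv₂ : v ∈ A₂ := by simp [hA₂, hv, hvρ]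
  have mem₂ (x : α) (hx : x ∈ A₂) : x ∈ A ∧ innerScore r x = ρ + 1 := by
    rw [hA₂, Finset.mem_filter] at hx
    have := hval x hx.1
    exact ⟨hx.1, by omega⟩
  have mem₁ (x : α) (hx : x ∈ A₁) : x ∈ A ∧ innerScore r x = ρ := Finset.mem_filter.1 hx
  have hpos₁ := Finset.card_pos.2 ⟨u, hu₁⟩
  have hpos₂ := Finset.card_pos.2 ⟨v, hv₂⟩
  have hsum : ∑ x ∈ A, (A.filter (r x)).card = A₁.card * ρ + A₂.card * (ρ + 1) := by
    rw [← Finset.sum_filter_add_sum_filter_not A fun x => innerScore r x = ρ]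
    congr 1
    · rw [Finset.sum_const_nat]
      intro x hx
      rw [← hinner x ((memA x).1 (mem₁ x hx).1), (mem₁ x hx).2]
    · rw [Finset.sum_const_nat]
      intro x hx
      rw [← hinner x ((memA x).1 (mem₂ x hx).1), (mem₂ x hx).2]
  have htwo := hr.1.two_mul_sum_inner A
  rw [hsum] at htwo
  have hhalf : A.card = 2 * A₂.card := by
    have hdvd : A.card ∣ 2 * A₂.card := by
      have h1 : A.card * (2 * ρ + 1) + 2 * A₂.card = A.card * A.card := by
        rw [← htwo, ← hcard]
        ring
      exact (Nat.dvd_add_right (dvd_mul_right _ _)).1 (h1 ▸ dvd_mul_right _ _)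
    obtain ⟨k, hk⟩ := hdvd
    have h1 : k < 2 := by
      by_contra! h
      have := Nat.mul_le_mul_left A.card h
      omega
    interval_cases k <;> omega
  have hm : A₂.card = ρ + 1 := by
    have h1 : A₁.card = A₂.card := by omega
    have h2 : A₂.card * (2 * ρ + 2) = A₂.card * (2 * A₂.card) := by
      rw [h1, hhalf] at htwo
      nlinarith
    have := Nat.eq_of_mul_eq_mul_left hpos₂ h2
    omega
  obtain ⟨u₁, hu₁, u₂, hu₂, h12⟩ : ∃ u₁ ∈ A₁, ∃ u₂ ∈ A₂, r u₁ u₂ := by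
    by_contra! hno
    have hbeat (x : α) (hx : x ∈ A₂) : A₁ = A.filter (r x) := by
      refine Finset.eq_of_subset_of_card_le (fun y hy => ?_) ?_
      · refine Finset.mem_filter.2 ⟨(mem₁ y hy).1, hr.1.total ?_ (hno y hy x hx)⟩
        rintro rfl
        have := (mem₁ y hy).2
        have := (mem₂ y hx).2
        omega
      · rw [← hinner x ((memA x).1 (mem₂ x hx).1), (mem₂ x hx).2]
        omega
    have hno₂ (x y : α) (hx : x ∈ A₂) (hy : y ∈ A₂) : ¬ r x y := by
      intro hxy
      have h1 : y ∈ A₁ := by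
        rw [hbeat x hx]
        exact Finset.mem_filter.2 ⟨(mem₂ y hy).1, hxy⟩
      have := (mem₁ y h1).2
      have := (mem₂ y hy).2
      omega
    obtain ⟨x, hx, y, hy, hxy⟩ := Finset.one_lt_card.1 (show 1 < A₂.card by omega)
    exact hno₂ y x hy hx (hr.1.total hxy (hno₂ x y hx hy))
  have hs₁ := (memA u₁).1 (mem₁ u₁ hu₁).1
  have hs₂ := (memA u₂).1 (mem₂ u₂ hu₂).1
  have hi₁ := (mem₁ u₁ hu₁).2
  have hi₂ := (mem₂ u₂ hu₂).2
  have ho₁ := innerScore_add_outerScore r u₁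
  have ho₂ := innerScore_add_outerScore r u₂
  have hsub := hr.outer_subset h12 (by omega) (by omega)
  obtain ⟨w₀, hw₀⟩ := Finset.card_eq_one.1
    (show ((Finset.univ.filter fun y => r u₁ y ∧ score r y ≠ score r u₁) \
      (Finset.univ.filter fun y => r u₂ y ∧ score r y ≠ score r u₂)).card = 1 by
        rw [Finset.card_sdiff_of_subset hsub]
        change outerScore r u₁ - outerScore r u₂ = 1
        omega)
  have hdiff (w : α) (hw : score r w ≠ a) : (r u₁ w ∧ ¬ r u₂ w) ↔ w = w₀ := by
    have := Finset.ext_iff.1 hw₀ w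
    simpa [hs₁, hs₂, hw] using this
  have hw₀a : score r w₀ ≠ a := by
    have := hw₀.symm ▸ Finset.mem_singleton_self w₀
    simp only [Finset.mem_sdiff, Finset.mem_filter, Finset.mem_univ, true_and] at this
    omega
  have hunif₁ (x w : α) (hx : x ∈ A₁) (hw : score r w ≠ a) : r w x ↔ r w u₁ := by
    have h1 := (memA x).1 (mem₁ x hx).1
    exact hr.rel_iff_of_innerScore_eq (by omega) (by rw [(mem₁ x hx).2, hi₁]) (by omega)
  have hunif₂ (x w : α) (hx : x ∈ A₂) (hw : score r w ≠ a) : r w x ↔ r w u₂ := by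
    have h1 := (memA x).1 (mem₂ x hx).1
    exact hr.rel_iff_of_innerScore_eq (by omega) (by rw [(mem₂ x hx).2, hi₂]) (by omega)
  have hsplit (w : α) : (A.filter (r w)).card =
      (A₁.filter (r w)).card + (A₂.filter (r w)).card := by
    rw [← Finset.card_filter_add_card_filter_not (s := A.filter (r w))
      fun x => innerScore r x = ρ, hA₁, hA₂]
    congr 1 <;> rw [Finset.filter_comm]
  have hc₁ (w : α) (hw : score r w ≠ a) :
      (A₁.filter (r w)).card = if r w u₁ then A₁.card else 0 := by
    split_ifs with h
    · rw [Finset.filter_true_of_mem fun x hx => (hunif₁ x w hx hw).2 h]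
    · rw [Finset.filter_false_of_mem fun x hx => mt (hunif₁ x w hx hw).1 h, Finset.card_empty]
  have hc₂ (w : α) (hw : score r w ≠ a) :
      (A₂.filter (r w)).card = if r w u₂ then A₂.card else 0 := by
    split_ifs with h
    · rw [Finset.filter_true_of_mem fun x hx => (hunif₂ x w hx hw).2 h]
    · rw [Finset.filter_false_of_mem fun x hx => mt (hunif₂ x w hx hw).1 h, Finset.card_empty]
  obtain ⟨hw₁, hw₂⟩ := (hdiff w₀ hw₀a).2 rfl
  have hrel (u w : α) (hu : score r u = a) (hw : score r w ≠ a) : r w u ↔ ¬ r u w :=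
    ⟨hr.1.asymm, hr.1.total (by rintro rfl; exact hw hu)⟩
  have hn₀ : (A.filter (r w₀)).card = A₂.card := by
    rw [hsplit, hc₁ w₀ hw₀a, hc₂ w₀ hw₀a, hrel u₁ w₀ hs₁ hw₀a, hrel u₂ w₀ hs₂ hw₀a]
    simp [hw₁, hw₂]
  have honly (w : α) (hw : score r w ≠ a) : w = w₀ := by
    by_contra hne
    have h1 : r u₁ w → r u₂ w := by
      have := hdiff w hw
      tauto
    have h2 : r u₂ w → r u₁ w := by
      intro h
      have := hsub (show w ∈ Finset.univ.filter fun y => r u₂ y ∧ score r y ≠ score r u₂ by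
        simp [h, hs₂, hw])
      exact (Finset.mem_filter.1 this).2.1
    have h3 : (A.filter (r w)).card = 0 ∨ (A.filter (r w)).card = A.card := by
      rw [hsplit, hc₁ w hw, hc₂ w hw, hrel u₁ w hs₁ hw, hrel u₂ w hs₂ hw]
      by_cases h : r u₁ w
      · simp [h, h1 h]
      · simp [h, mt h2 h, hcard]
    have h4 := hrange w w₀ hw hw₀a
    have h5 := hrange w₀ w hw₀a hw
    omega
  have hout : outerScore r u₂ = 0 := by
    rw [outerScore, Finset.card_eq_zero, Finset.filter_eq_empty_iff]
    rintro w - ⟨h1, h2⟩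
    rw [honly w (by omega)] at h1
    exact hw₂ h1
  have hin : innerScore r w₀ = 0 := by
    rw [innerScore, Finset.card_eq_zero, Finset.filter_eq_empty_iff]
    rintro w - ⟨h1, h2⟩
    rw [honly w (by omega)] at h1
    exact hr.1.1 _ h1
  have h1 := innerScore_add_outerScore r w₀
  rw [houter w₀ hw₀a] at h1
  omega

end UniqueTournament

end ScoreClass

/-! ### Regular tournaments -/

section Regular

/-- The rotational tournament on `2 * m + 1` vertices: each vertex beats the next `m`. -/
def rotational (m : ℕ) (i j : Fin (2 * m + 1)) : Prop :=
  (i.1 < j.1 ∧ j.1 ≤ i.1 + m) ∨ (j.1 < i.1 ∧ j.1 + m + 1 ≤ i.1)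

variable {m : ℕ}

lemma isTournament_rotational : IsTournament (rotational m) := by
  refine .of_asymm_total (fun x y => ?_) fun x y hne => ?_
  · unfold rotational
    omega
  · unfold rotational
    have := x.2
    have := y.2
    have := Fin.val_ne_of_ne hne
    omega

lemma score_rotational (i : Fin (2 * m + 1)) : score (rotational m) i = m := by
  classical
  rw [score_eq_card_filter, ← Finset.card_map Fin.valEmbedding]
  have hi := i.2
  rcases le_or_gt i.1 m with h | h
  · trans (Finset.Ioc i.1 (i.1 + m)).card
    · congr 1
      ext j
      simp only [Finset.mem_map, Finset.mem_filter, Finset.mem_univ, true_and,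
        Fin.valEmbedding_apply, Finset.mem_Ioc, rotational]
      constructor
      · rintro ⟨j, hj, rfl⟩
        omega
      · intro hj
        exact ⟨⟨j, by omega⟩, Or.inl hj, rfl⟩
    · simp
  · trans (Finset.Ioo i.1 (2 * m + 1) ∪ Finset.range (i.1 - m)).card
    · congr 1
      ext j
      simp only [Finset.mem_map, Finset.mem_filter, Finset.mem_univ, true_and,
        Fin.valEmbedding_apply, Finset.mem_union, Finset.mem_Ioo, Finset.mem_range, rotational]
      constructor
      · rintro ⟨j, hj, rfl⟩
        have := j.2
        omega
      · intro hj
        exact ⟨⟨j, by omega⟩, by simp only; omega, rfl⟩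
    · rw [Finset.card_union_of_disjoint, Nat.card_Ioo, Finset.card_range]
      · omega
      · rw [Finset.disjoint_left]
        intro j
        simp only [Finset.mem_Ioo, Finset.mem_range]
        omega

lemma not_rotational_of_cyclicTriple {x a b c : Fin (2 * m + 1)}
    (h : CyclicTriple (rotational m) a b c) :
    ¬ (rotational m x a ∧ rotational m x b ∧ rotational m x c) := by
  unfold CyclicTriple rotational at h
  unfold rotational
  have := x.2
  have := a.2
  have := b.2
  have := c.2
  omega

lemma UniqueTournament.le_two_of_regular {α : Type} [Fintype α] {r : α → α → Prop}
    (hr : UniqueTournament r) (hcard : Fintype.card α = 2 * m + 1) (hm : ∀ x, score r x = m) :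
    m ≤ 2 := by
  by_contra! h
  have e : α ≃ Fin (2 * m + 1) := Fintype.equivFinOfCardEq hcard
  obtain ⟨r', hi⟩ := Isomorphic.exists_transport (rotational m) e.symm
  have hu : UniqueTournament (rotational m) := by
    refine hr.of_isomorphic ((hr.2 r' (hi.isTournament isTournament_rotational) ?_).trans hi.symm)
    rw [← hi.scoreMultiset_eq]
    simp only [scoreMultiset, funext hm, funext score_rotational, Multiset.map_const']
    simp [hcard]
  have hT : CyclicTriple (rotational m) ⟨0, by omega⟩ ⟨2, by omega⟩ ⟨m + 1, by omega⟩ := by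
    unfold CyclicTriple rotational
    simp only
    omega
  obtain ⟨f, hf⟩ := hu.flipTriple_isomorphic hT |>.symm
  refine not_rotational_of_cyclicTriple (a := f ⟨0, by omega⟩) (b := f ⟨1, by omega⟩)
    (c := f ⟨2, by omega⟩) (x := f ⟨2 * m, by omega⟩) ?_ ?_
  · simp only [CyclicTriple, ← hf]
    simp only [_root_.flipTriple, rotational, Fin.ext_iff]
    refine ⟨?_, ?_, ?_⟩ <;> grind
  · simp only [← hf]
    simp only [_root_.flipTriple, rotational, Fin.ext_iff]
    omega

end Regular

/-! ### The tournaments attached to blocks -/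

section Blocks

variable {α : Type} [Fintype α] {r : α → α → Prop}

lemma exists_unique_of_score_eq_one {x : α} (h : score r x = 1) :
    ∃ y, r x y ∧ ∀ z, r x z → z = y := by
  classical
  rw [score_eq_card_filter, Finset.card_eq_one] at h
  obtain ⟨y, hy⟩ := h
  simp only [Finset.ext_iff, Finset.mem_filter, Finset.mem_univ, true_and,
    Finset.mem_singleton] at hy
  exact ⟨y, (hy y).2 rfl, fun z => (hy z).1⟩

lemma IsTournament.exists_pair_of_score_eq_two (hr : IsTournament r) {x : α}
    (h : score r x = 2) : ∃ y z, r x y ∧ r x z ∧ r y z ∧ ∀ w, r x w → w = y ∨ w = z := by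
  classical
  rw [score_eq_card_filter, Finset.card_eq_two] at h
  obtain ⟨y, z, hne, hyz⟩ := h
  simp only [Finset.ext_iff, Finset.mem_filter, Finset.mem_univ, true_and,
    Finset.mem_insert, Finset.mem_singleton] at hyz
  by_cases h : r y z
  · exact ⟨y, z, (hyz y).2 (.inl rfl), (hyz z).2 (.inr rfl), h, fun w => (hyz w).1⟩
  · exact ⟨z, y, (hyz z).2 (.inr rfl), (hyz y).2 (.inl rfl), hr.total hne h,
      fun w hw => ((hyz w).1 hw).symm⟩

lemma scoreMultiset_eq_replicate {m : ℕ} (h : ∀ x, score r x = m) :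
    scoreMultiset r = Multiset.replicate (Fintype.card α) m := by
  simp only [scoreMultiset, funext h, Multiset.map_const', Finset.card_val, Finset.card_univ]

lemma scoreMultiset_rotational (m : ℕ) :
    scoreMultiset (rotational m) = Multiset.replicate (2 * m + 1) m := by
  rw [scoreMultiset_eq_replicate score_rotational, Fintype.card_fin]

lemma uniqueTournament_rotational {m : ℕ} (hm : m ≤ 2) : UniqueTournament (rotational m) := by
  refine ⟨isTournament_rotational, fun r hr hs => ?_⟩
  have hsc (x) : score r x = m := by
    rw [scoreMultiset_rotational, Multiset.eq_replicate] at hs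
    exact hs.2 _ (Multiset.mem_map_of_mem _ (Finset.mem_univ x))
  interval_cases m
  · refine .of_map isTournament_rotational hr rfl id fun x y h => ?_
    exact absurd (Subsingleton.elim (α := Fin 1) x y) (isTournament_rotational.ne h)
  · obtain ⟨a, ha, ha'⟩ := exists_unique_of_score_eq_one (hsc 0)
    obtain ⟨b, hb, hb'⟩ := exists_unique_of_score_eq_one (hsc a)
    have hb0 : r b 0 := by
      refine hr.total ?_ fun h => hr.ne hb (ha' b h).symm
      rintro rfl
      exact hr.asymm ha hb
    refine .of_map isTournament_rotational hr rfl ![0, a, b] fun x y h => ?_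
    fin_cases x <;> fin_cases y <;> first | (simp [rotational] at h; done) | assumption
  · obtain ⟨a, b, ha, hb, hab, h0⟩ := hr.exists_pair_of_score_eq_two (hsc 0)
    obtain ⟨c, d, hc, hd, hcd, hB⟩ := hr.exists_pair_of_score_eq_two (hsc b)
    have hout (x : Fin (2 * 2 + 1)) (hx : r b x) : r x 0 := by
      refine hr.total ?_ fun h => ?_
      · rintro rfl
        exact hr.asymm hb hx
      · rcases h0 x h with rfl | rfl
        · exact hr.asymm hab hx
        · exact hr.1 _ hx
    have hc0 := hout c hc
    have hd0 := hout d hd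
    have hne (x : Fin (2 * 2 + 1)) (hx : r b x) : x ≠ a := by
      rintro rfl
      exact hr.asymm hab hx
    have hac : r a c := by
      refine hr.total (hne c hc) fun h => ?_
      obtain ⟨y, z, -, -, -, hC⟩ := hr.exists_pair_of_score_eq_two (hsc c)
      have h1 := hC _ h
      have h2 := hC _ hc0
      have h3 := hC _ hcd
      have h4 := hr.ne ha
      have h5 := hr.ne hd0
      have h6 := hne d hd
      grind
    have hda : r d a := by
      refine hr.total (hne d hd).symm fun h => ?_
      obtain ⟨y, z, -, -, -, hA⟩ := hr.exists_pair_of_score_eq_two (hsc a)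
      have h1 := hA _ h
      have h2 := hA _ hac
      have h3 := hA _ hab
      have h4 := hr.ne hc
      have h5 := hr.ne hcd
      have h6 := hr.ne hd
      grind
    refine .of_map isTournament_rotational hr rfl ![0, a, b, c, d] fun x y h => ?_
    fin_cases x <;> fin_cases y <;> first | (simp [rotational] at h; done) | assumption

/-- The strong tournament on four vertices. -/
def strongFour (i j : Fin 4) : Prop :=
  (i, j) ∈ ({(0, 1), (1, 2), (2, 0), (2, 3), (3, 0), (3, 1)} : Finset (Fin 4 × Fin 4))

instance : DecidableRel strongFour := fun i j => by
  unfold strongFour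
  infer_instance

lemma scoreMultiset_strongFour : scoreMultiset strongFour = {1, 1, 2, 2} := by
  rw [scoreMultiset, show score strongFour = fun i => (Finset.univ.filter (strongFour i)).card from
    funext fun i => by rw [score_eq_card_filter]; congr]
  decide

lemma isTournament_strongFour : IsTournament strongFour :=
  .of_asymm_total (by decide) (by decide)

lemma exists_pair_of_count_eq_two (hr : IsTournament r) {s : ℕ}
    (h : (scoreMultiset r).count s = 2) :
    ∃ x y, r x y ∧ ∀ z, score r z = s ↔ z = x ∨ z = y := by
  classical
  have h : (Finset.univ.filter fun x => s = score r x).card = 2 := by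
    rwa [scoreMultiset, Multiset.count_map] at h
  obtain ⟨x, y, hne, hxy⟩ := Finset.card_eq_two.1 h
  simp only [Finset.ext_iff, Finset.mem_filter, Finset.mem_univ, true_and,
    Finset.mem_insert, Finset.mem_singleton, eq_comm (a := s)] at hxy
  by_cases h : r x y
  · exact ⟨x, y, h, hxy⟩
  · exact ⟨y, x, hr.total hne h, fun z => (hxy z).trans or_comm⟩

lemma uniqueTournament_strongFour : UniqueTournament strongFour := by
  refine ⟨isTournament_strongFour, fun r hr hs => ?_⟩
  rw [scoreMultiset_strongFour] at hs
  obtain ⟨a, b, hab, h1⟩ := exists_pair_of_count_eq_two hr (s := 1) (by rw [hs]; rfl)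
  obtain ⟨c, d, hcd, h2⟩ := exists_pair_of_count_eq_two hr (s := 2) (by rw [hs]; rfl)
  have ha := (h1 a).2 (.inl rfl)
  have hb := (h1 b).2 (.inr rfl)
  have hc := (h2 c).2 (.inl rfl)
  have hd := (h2 d).2 (.inr rfl)
  have hne (x y : Fin 4) (hx : score r x = 1) (hy : score r y = 2) : x ≠ y := by
    rintro rfl
    omega
  obtain ⟨x, -, hA⟩ := exists_unique_of_score_eq_one ha
  have hca : r c a := hr.total (hne a c ha hc) fun h =>
    hne b c hb hc ((hA b hab).trans (hA c h).symm)
  have hda : r d a := hr.total (hne a d ha hd) fun h =>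
    hne b d hb hd ((hA b hab).trans (hA d h).symm)
  have hbc : r b c := by
    refine hr.total (hne b c hb hc).symm fun h => ?_
    obtain ⟨y, z, -, -, -, hC⟩ := hr.exists_pair_of_score_eq_two hc
    have h1 := hC _ h
    have h2 := hC _ hca
    have h3 := hC _ hcd
    have h4 := hr.ne hab
    have h5 := hne a d ha hd
    have h6 := hne b d hb hd
    grind
  obtain ⟨y, -, hB⟩ := exists_unique_of_score_eq_one hb
  have hdb : r d b := hr.total (hne b d hb hd) fun h =>
    hr.ne hcd ((hB c hbc).trans (hB d h).symm)
  refine .of_map isTournament_strongFour hr rfl ![a, b, c, d] fun x y h => ?_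
  fin_cases x <;> fin_cases y <;> first | (simp [strongFour] at h; done) | assumption

lemma Block.exists_uniqueTournament (b : Block) :
    ∃ r : Fin b.size → Fin b.size → Prop, UniqueTournament r ∧ scoreMultiset r = b.scores := by
  cases b with
  | one => exact ⟨rotational 0, uniqueTournament_rotational (by norm_num),
      scoreMultiset_rotational _⟩
  | three => exact ⟨rotational 1, uniqueTournament_rotational (by norm_num),
      scoreMultiset_rotational _⟩
  | four => exact ⟨strongFour, uniqueTournament_strongFour, scoreMultiset_strongFour⟩
  | five => exact ⟨rotational 2, uniqueTournament_rotational le_rfl,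
      scoreMultiset_rotational _⟩

/-! ### Strong unique tournaments have the scores of a block -/

lemma StrongTournament.one_le_score (hs : StrongTournament r) (hr : IsTournament r)
    (hcard : 2 ≤ Fintype.card α) (x : α) : 1 ≤ score r x ∧ score r x + 2 ≤ Fintype.card α := by
  classical
  have hne : ({x} : Set α)ᶜ.Nonempty := by
    have : Nontrivial α := Fintype.one_lt_card_iff_nontrivial.1 hcard
    obtain ⟨y, hy⟩ := exists_ne x
    exact ⟨y, hy⟩
  constructor
  · obtain ⟨_, rfl, y, -, hxy⟩ := hs {x} ⟨x, rfl⟩ hne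
    rw [score_eq_card_filter, Nat.one_le_iff_ne_zero, ← Nat.pos_iff_ne_zero, Finset.card_pos]
    exact ⟨y, by simpa using hxy⟩
  · obtain ⟨y, hy, z, hz, hyz⟩ := hs {x}ᶜ hne ⟨x, by simp⟩
    obtain rfl : z = x := by simpa using hz
    have hsub : (Finset.univ.filter (r z)) ⊆ (Finset.univ.erase z).erase y := by
      intro w hw
      simp only [Finset.mem_filter, Finset.mem_univ, true_and, Finset.mem_erase, and_true] at hw ⊢
      refine ⟨?_, (hr.ne hw).symm⟩
      rintro rfl
      exact hr.asymm hw hyz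
    have := Finset.card_le_card hsub
    rw [Finset.card_erase_of_mem (by simpa using hy), Finset.card_erase_of_mem (Finset.mem_univ _),
      Finset.card_univ, ← score_eq_card_filter] at this
    omega

theorem UniqueTournament.exists_block [Nonempty α] (hr : UniqueTournament r)
    (hs : StrongTournament r) : ∃ b : Block, scoreMultiset r = b.scores := by
  classical
  obtain ⟨p, q, hpq⟩ := hr.exists_two_scores hs
  have htwo := hr.1.two_mul_sum_score
  have hpos := Fintype.card_pos (α := α)
  have hregular (m : ℕ) (hm : ∀ x, score r x = m) : ∃ b : Block, scoreMultiset r = b.scores := by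
    have hcard : Fintype.card α = 2 * m + 1 := by
      simp only [hm, Finset.sum_const, Finset.card_univ, smul_eq_mul] at htwo
      nlinarith
    have h2 := hr.le_two_of_regular hcard hm
    rw [scoreMultiset_eq_replicate hm, hcard]
    interval_cases m
    · exact ⟨.one, rfl⟩
    · exact ⟨.three, rfl⟩
    · exact ⟨.five, rfl⟩
  by_cases hp : ∀ x, score r x = p
  · exact hregular p hp
  by_cases hq : ∀ x, score r x = q
  · exact hregular q hq
  push Not at hp hq
  have h1 := hr.card_scoreClass_le_two hs hpq hp
  have h2 := hr.card_scoreClass_le_two hs (fun x => (hpq x).symm) hq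
  obtain ⟨x, hx⟩ := hp
  obtain ⟨y, hy⟩ := hq
  have hxq : score r x = q := (hpq x).resolve_left hx
  have hyp : score r y = p := (hpq y).resolve_right hy
  have hne : p ≠ q := by omega
  have hq' : (Finset.univ.filter fun z => ¬ score r z = p) =
      Finset.univ.filter fun z => score r z = q := by
    ext z
    have := hpq z
    simp only [Finset.mem_filter, Finset.mem_univ, true_and]
    omega
  have hsum := Finset.card_filter_add_card_filter_not (s := (Finset.univ : Finset α))
    fun z => score r z = p
  rw [hq', Finset.card_univ] at hsum
  have hcard2 : 2 ≤ Fintype.card α := Fintype.one_lt_card_iff.2 ⟨x, y, by rintro rfl; omega⟩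
  obtain ⟨hx1, hx2⟩ := hs.one_le_score hr.1 hcard2 x
  obtain ⟨hy1, hy2⟩ := hs.one_le_score hr.1 hcard2 y
  have hp2 : (Finset.univ.filter fun z => score r z = p).card = 2 := by omega
  have hq2 : (Finset.univ.filter fun z => score r z = q).card = 2 := by omega
  have hmul : scoreMultiset r = Multiset.replicate 2 p + Multiset.replicate 2 q := by
    rw [scoreMultiset, ← Multiset.filter_add_not (fun z => score r z = p) Finset.univ.val,
      Multiset.map_add]
    congr 1
    · rw [Multiset.eq_replicate]
      refine ⟨by rw [Multiset.card_map]; exact hp2, fun b hb => ?_⟩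
      obtain ⟨z, hz, rfl⟩ := Multiset.mem_map.1 hb
      exact (Multiset.mem_filter.1 hz).2
    · rw [Multiset.eq_replicate]
      rw [← hq'] at hq2
      refine ⟨by rw [Multiset.card_map]; exact hq2, fun b hb => ?_⟩
      obtain ⟨z, hz, rfl⟩ := Multiset.mem_map.1 hb
      exact (hpq z).resolve_left (Multiset.mem_filter.1 hz).2
  refine ⟨.four, ?_⟩
  rw [hmul]
  obtain ⟨rfl, rfl⟩ | ⟨rfl, rfl⟩ : (p = 1 ∧ q = 2) ∨ (p = 2 ∧ q = 1) := by omega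
  · rfl
  · decide

end Blocks

/-! ### Unique tournaments are compositions of blocks -/

section Structure

theorem UniqueTournament.exists_totalScores {α : Type} [Fintype α] {r : α → α → Prop}
    (hr : UniqueTournament r) : ∃ bs, scoreMultiset r = Block.totalScores bs := by
  classical
  induction hn : Fintype.card α using Nat.strong_induction_on generalizing α with
  | _ n ih =>
    subst hn
    cases isEmpty_or_nonempty α with
    | inl h => exact ⟨[], by simp [scoreMultiset, Block.totalScores]⟩
    | inr h =>
      obtain ⟨X, ⟨hX, hXr⟩, hmin⟩ := (Set.toFinite
        {X : Set α | X.Nonempty ∧ ∀ x ∈ X, ∀ y ∉ X, ¬ r x y}).exists_minimal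
          ⟨Set.univ, Set.univ_nonempty, by simp⟩
      set A : {x // x ∈ X} → {x // x ∈ X} → Prop := fun x y => r x y with hA
      set B : {x // x ∉ X} → {x // x ∉ X} → Prop := fun x y => r x y with hB
      have hi : Isomorphic (_root_.compT A B) r :=
        hr.1.isomorphic_compT (· ∈ X) fun x y hx hy => hXr x hx y hy
      have hAt : IsTournament A := hr.1.onFun Subtype.val_injective
      have hBt : IsTournament B := hr.1.onFun Subtype.val_injective
      have hu := hr.of_isomorphic hi.symm
      have hs : StrongTournament A := by
        intro Y hY hYc
        by_contra! hno
        obtain ⟨z, hz⟩ := hYc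
        obtain ⟨y, hy⟩ := hY
        have hle : Subtype.val '' Y ⊆ X := by
          rintro _ ⟨x, -, rfl⟩
          exact x.2
        have hYr : ∀ x ∈ Subtype.val '' Y, ∀ t ∉ Subtype.val '' Y, ¬ r x t := by
          rintro _ ⟨x, hx, rfl⟩ t ht hxt
          by_cases htX : t ∈ X
          · exact hno x hx ⟨t, htX⟩ (fun h => ht ⟨_, h, rfl⟩) hxt
          · exact hXr x x.2 t htX hxt
        obtain ⟨w, hw, hwz⟩ := hmin (y := Subtype.val '' Y) ⟨⟨y, y, hy, rfl⟩, hYr⟩ hle z.2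
        exact hz (Subtype.ext hwz ▸ hw)
      have : Nonempty {x // x ∈ X} := hX.to_subtype
      obtain ⟨b, hb⟩ := (hu.left hAt hBt).exists_block hs
      obtain ⟨x, hx⟩ := hX
      obtain ⟨bs, hbs⟩ := ih _ (Fintype.card_subtype_lt (x := x) (by simpa using hx))
        (hu.right hAt hBt) rfl
      refine ⟨b :: bs, ?_⟩
      rw [← hi.scoreMultiset_eq, scoreMultiset_compT, hb, hbs, Block.totalScores,
        ← b.card_scores, ← hb, card_scoreMultiset]

lemma Block.exists_uniqueTournament_totalScores (bs : List Block) :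
    ∃ r : Fin (totalSize bs) → Fin (totalSize bs) → Prop,
      UniqueTournament r ∧ scoreMultiset r = totalScores bs := by
  induction bs with
  | nil =>
    refine ⟨fun _ _ => False, ⟨⟨fun i => i.elim0, fun i => i.elim0⟩, fun r' _ _ => ?_⟩, rfl⟩
    exact ⟨Equiv.refl _, fun i => i.elim0⟩
  | cons b bs ih =>
    obtain ⟨A, hA, hAs⟩ := b.exists_uniqueTournament
    obtain ⟨B, hB, hBs⟩ := ih
    obtain ⟨r, hr⟩ := Isomorphic.exists_transport (compT A B) finSumFinEquiv
    refine ⟨r, (hA.compT hB).of_isomorphic hr, hr.scoreMultiset_eq.symm.trans ?_⟩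
    rw [scoreMultiset_compT, hAs, hBs, totalScores, Fintype.card_fin]

end Structure

/-- For `k ≥ 1`, the number of non-tracking binary strings of length `k` equals the
number of score multisets that determine a tournament on `k + 2` vertices uniquely up
to isomorphism. -/
theorem NTr_eq_card_unique_tournaments (k : ℕ) (hk : 1 ≤ k) :
    NTr k = Nat.card {d : Multiset ℕ //
      (∃ r : Fin (k + 2) → Fin (k + 2) → Prop, IsTournament r ∧ scoreMultiset r = d) ∧
      ∀ r r' : Fin (k + 2) → Fin (k + 2) → Prop, IsTournament r → IsTournament r' →
        scoreMultiset r = d → scoreMultiset r' = d → Isomorphic r r'} := by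
  rw [NTr_eq_card_blocks]
  have key (bs : {bs : List Block // Block.totalSize bs = k + 2}) :
      ∃ r : Fin (k + 2) → Fin (k + 2) → Prop,
        UniqueTournament r ∧ scoreMultiset r = Block.totalScores bs.1 := by
    obtain ⟨bs, hbs⟩ := bs
    change ∃ r : Fin (k + 2) → Fin (k + 2) → Prop,
      UniqueTournament r ∧ scoreMultiset r = Block.totalScores bs
    rw [← hbs]
    exact Block.exists_uniqueTournament_totalScores bs
  refine Nat.card_congr (Equiv.ofBijective (fun bs => ⟨Block.totalScores bs.1, ?_, ?_⟩) ⟨?_, ?_⟩)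
  · obtain ⟨r, hr, hs⟩ := key bs
    exact ⟨r, hr.1, hs⟩
  · intro r r' hr hr' hs hs'
    obtain ⟨q, hq, hqs⟩ := key bs
    exact (hq.2 r hr (hs.trans hqs.symm)).symm.trans (hq.2 r' hr' (hs'.trans hqs.symm))
  · exact fun bs cs h => Subtype.ext (Block.totalScores_injective (congrArg Subtype.val h))
  · rintro ⟨d, ⟨r, hr, hs⟩, h⟩
    obtain ⟨bs, hbs⟩ := UniqueTournament.exists_totalScores
      ⟨hr, fun r' hr' hs' => h r r' hr hr' hs (hs'.trans hs)⟩
    refine ⟨⟨bs, ?_⟩, Subtype.ext (hbs.symm.trans hs)⟩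
    rw [← Block.card_totalScores, ← hbs, card_scoreMultiset, Fintype.card_fin]
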